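/- Let x, y ∈ [0,1] and let f : [0,1]^2 → ℝ be twice continuously differentiable. Then the limit as n → ∞ of n · ( B_n^{[2]}f(x,y) - f(x,y) ) equals (x(1-x)/2) · ∂²f/∂x² (x,y) + (y(1-y)/2) · ∂²f/∂y² (x,y). -/

import Mathlib

open Filter Finset

/-- Bernstein basis polynomial `p_{n,k}(x) = C(n,k) x^k (1-x)^{n-k}`. -/
noncomputable def bern (n k : ℕ) (x : ℝ) : ℝ := (n.choose k : ℝ) * x ^ k * (1 - x) ^ (n - k)

/-- The AKR node `t_{n,k} = √(k(k-1)/(n(n-1)))`. -/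
noncomputable def akrNode (n k : ℕ) : ℝ := Real.sqrt ((k * (k - 1)) / (n * (n - 1)))

/-- The unit square `[0,1]²`. -/
def unitSquare : Set (ℝ × ℝ) := Set.Icc 0 1 ×ˢ Set.Icc 0 1

/-- Partial derivative in the first variable, taken within `[0,1]`. -/
noncomputable def pderivX (f : ℝ × ℝ → ℝ) (p : ℝ × ℝ) : ℝ :=
  derivWithin (fun s => f (s, p.2)) (Set.Icc 0 1) p.1

/-- Partial derivative in the second variable, taken within `[0,1]`. -/
noncomputable def pderivY (f : ℝ × ℝ → ℝ) (p : ℝ × ℝ) : ℝ :=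
  derivWithin (fun t => f (p.1, t)) (Set.Icc 0 1) p.2

/-- The bivariate tensor-product Bernstein operator
`B_n^{[2]} f(x,y) = Σ_{k=0}^n Σ_{l=0}^n f(k/n, l/n) p_{n,k}(x) p_{n,l}(y)`. -/
noncomputable def bernstein2Op (n : ℕ) (f : ℝ × ℝ → ℝ) (x y : ℝ) : ℝ :=
  ∑ k ∈ Finset.range (n + 1), ∑ l ∈ Finset.range (n + 1),
    f ((k : ℝ) / n, (l : ℝ) / n) * bern n k x * bern n l y

/-- The bivariate Aldaz–Kounchev–Render operator with `j = 2`: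
`B_{n,2}^{[2]} f(x,y) = Σ_{k=0}^n Σ_{l=0}^n f(t_{n,k}, t_{n,l}) p_{n,k}(x) p_{n,l}(y)`. -/
noncomputable def akr2Op (n : ℕ) (f : ℝ × ℝ → ℝ) (x y : ℝ) : ℝ :=
  ∑ k ∈ Finset.range (n + 1), ∑ l ∈ Finset.range (n + 1),
    f (akrNode n k, akrNode n l) * bern n k x * bern n l y

/-! ### Central moments of the Bernstein basis -/

lemma bern_nonneg (n k : ℕ) {x : ℝ} (hx : x ∈ Set.Icc (0 : ℝ) 1) : 0 ≤ bern n k x := by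
  have h0 := hx.1
  have h1 : 0 ≤ 1 - x := by linarith [hx.2]
  unfold bern
  positivity

lemma bern_succ_zero (n : ℕ) (x : ℝ) : bern (n + 1) 0 x = (1 - x) * bern n 0 x := by
  simp only [bern, Nat.choose_zero_right, Nat.sub_zero]
  ring

lemma bern_succ_succ (n k : ℕ) (x : ℝ) :
    bern (n + 1) (k + 1) x = x * bern n k x + (1 - x) * bern n (k + 1) x := by
  simp only [bern, Nat.choose_succ_succ, Nat.add_sub_add_right]
  rcases lt_or_ge k n with h | h
  · obtain ⟨m, rfl⟩ := Nat.exists_eq_add_of_lt h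
    have h1 : k + m + 1 - k = m + 1 := by lia
    have h2 : k + m + 1 - (k + 1) = m := by lia
    rw [h1, h2]
    push_cast
    ring
  · rw [Nat.choose_eq_zero_of_lt (show n < k + 1 by lia)]
    push_cast
    ring

lemma bern_self_succ (n : ℕ) (x : ℝ) : bern n (n + 1) x = 0 := by
  simp [bern]

/-- The recursion for binomial expectations obtained by conditioning on the last trial. -/
lemma sum_bern_succ (n : ℕ) (x : ℝ) (g : ℕ → ℝ) :
    ∑ k ∈ range (n + 2), g k * bern (n + 1) k x
      = ∑ k ∈ range (n + 1), (x * g (k + 1) + (1 - x) * g k) * bern n k x := by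
  rw [sum_range_succ']
  simp only [bern_succ_succ, bern_succ_zero]
  have h : ∑ k ∈ range (n + 1), g (k + 1) * bern n (k + 1) x + g 0 * bern n 0 x
      = ∑ k ∈ range (n + 1), g k * bern n k x := by
    rw [← sum_range_succ' (fun k => g k * bern n k x), sum_range_succ, bern_self_succ]
    ring
  have h2 : ∑ k ∈ range (n + 1), (x * g (k + 1) + (1 - x) * g k) * bern n k x
      = ∑ k ∈ range (n + 1), x * (g (k + 1) * bern n k x)
        + (1 - x) * ∑ k ∈ range (n + 1), g k * bern n k x := by
    rw [mul_sum, ← sum_add_distrib]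
    exact sum_congr rfl fun k _ => by ring
  rw [h2, ← h, mul_add, mul_sum, ← add_assoc, ← sum_add_distrib]
  congr 1
  · exact sum_congr rfl fun k _ => by ring
  · ring

lemma sum_bern (n : ℕ) (x : ℝ) : ∑ k ∈ range (n + 1), bern n k x = 1 := by
  induction n with
  | zero => simp [bern]
  | succ n ih =>
    have h := sum_bern_succ n x (fun _ => 1)
    simpa [ih] using h

lemma sum_sub_mul_bern (n : ℕ) (x : ℝ) :
    ∑ k ∈ range (n + 1), ((k : ℝ) - n * x) * bern n k x = 0 := by
  induction n with
  | zero => simp [bern]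
  | succ n ih =>
    rw [sum_bern_succ n x (fun k => (k : ℝ) - (n + 1 : ℕ) * x), ← ih]
    refine sum_congr rfl fun k _ => ?_
    push_cast
    ring

lemma sum_sub_sq_mul_bern (n : ℕ) (x : ℝ) :
    ∑ k ∈ range (n + 1), ((k : ℝ) - n * x) ^ 2 * bern n k x = n * (x * (1 - x)) := by
  induction n with
  | zero => simp [bern]
  | succ n ih =>
    have key : ∀ k : ℕ, (x * (((k + 1 : ℕ) : ℝ) - (n + 1 : ℕ) * x) ^ 2
        + (1 - x) * ((k : ℝ) - (n + 1 : ℕ) * x) ^ 2) * bern n k x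
        = ((k : ℝ) - n * x) ^ 2 * bern n k x + x * (1 - x) * bern n k x := fun k => by
      push_cast
      ring
    rw [sum_bern_succ n x (fun k => ((k : ℝ) - (n + 1 : ℕ) * x) ^ 2)]
    simp only [key, sum_add_distrib, ← mul_sum, ih, sum_bern]
    push_cast
    ring

lemma sum_sub_pow_four_mul_bern (n : ℕ) (x : ℝ) :
    ∑ k ∈ range (n + 1), ((k : ℝ) - n * x) ^ 4 * bern n k x
      = 3 * n * (n - 1) * (x * (1 - x)) ^ 2 + n * (x * (1 - x) * (1 - 3 * x * (1 - x))) := by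
  induction n with
  | zero => simp [bern]
  | succ n ih =>
    have key : ∀ k : ℕ, (x * (((k + 1 : ℕ) : ℝ) - (n + 1 : ℕ) * x) ^ 4
        + (1 - x) * ((k : ℝ) - (n + 1 : ℕ) * x) ^ 4) * bern n k x
        = ((k : ℝ) - n * x) ^ 4 * bern n k x
          + 6 * (x * (1 - x)) * (((k : ℝ) - n * x) ^ 2 * bern n k x)
          + 4 * (x * (1 - x) * (1 - 2 * x)) * (((k : ℝ) - n * x) * bern n k x)
          + x * (1 - x) * (1 - 3 * x * (1 - x)) * bern n k x := fun k => by
      push_cast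
      ring
    rw [sum_bern_succ n x (fun k => ((k : ℝ) - (n + 1 : ℕ) * x) ^ 4)]
    simp only [key, sum_add_distrib, ← mul_sum, ih, sum_bern, sum_sub_mul_bern,
      sum_sub_sq_mul_bern]
    push_cast
    ring

lemma sum_div_sub_mul_bern {n : ℕ} (hn : n ≠ 0) (x : ℝ) :
    ∑ k ∈ range (n + 1), ((k : ℝ) / n - x) * bern n k x = 0 := by
  have hn' : (n : ℝ) ≠ 0 := Nat.cast_ne_zero.2 hn
  have key : ∀ k : ℕ, ((k : ℝ) / n - x) * bern n k x
      = (n : ℝ)⁻¹ * (((k : ℝ) - n * x) * bern n k x) := fun k => by field_simp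
  simp only [key, ← mul_sum, sum_sub_mul_bern, mul_zero]

lemma sum_div_sub_sq_mul_bern {n : ℕ} (hn : n ≠ 0) (x : ℝ) :
    ∑ k ∈ range (n + 1), ((k : ℝ) / n - x) ^ 2 * bern n k x = x * (1 - x) / n := by
  have hn' : (n : ℝ) ≠ 0 := Nat.cast_ne_zero.2 hn
  have key : ∀ k : ℕ, ((k : ℝ) / n - x) ^ 2 * bern n k x
      = ((n : ℝ) ^ 2)⁻¹ * (((k : ℝ) - n * x) ^ 2 * bern n k x) := fun k => by field_simp
  simp only [key, ← mul_sum, sum_sub_sq_mul_bern]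
  field_simp

lemma sum_div_sub_pow_four_mul_bern_le {n : ℕ} (hn : n ≠ 0) {x : ℝ}
    (hx : x ∈ Set.Icc (0 : ℝ) 1) :
    ∑ k ∈ range (n + 1), ((k : ℝ) / n - x) ^ 4 * bern n k x ≤ 4 / (n : ℝ) ^ 2 := by
  have hn' : (n : ℝ) ≠ 0 := Nat.cast_ne_zero.2 hn
  have hn1 : (1 : ℝ) ≤ n := by exact_mod_cast Nat.one_le_iff_ne_zero.2 hn
  have key : ∀ k : ℕ, ((k : ℝ) / n - x) ^ 4 * bern n k x
      = ((n : ℝ) ^ 4)⁻¹ * (((k : ℝ) - n * x) ^ 4 * bern n k x) := fun k => by field_simp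
  simp only [key, ← mul_sum, sum_sub_pow_four_mul_bern]
  have h0 : 0 ≤ x * (1 - x) := mul_nonneg hx.1 (by linarith [hx.2])
  have h1 : x * (1 - x) ≤ 1 := by nlinarith [sq_nonneg x, hx.2]
  have h2 : (x * (1 - x)) ^ 2 ≤ 1 := pow_le_one₀ h0 h1
  have h3 : x * (1 - x) * (1 - 3 * x * (1 - x)) ≤ 1 := by nlinarith
  have h4 : 3 * (n : ℝ) * (n - 1) * (x * (1 - x)) ^ 2 ≤ 3 * (n : ℝ) * (n - 1) * 1 :=
    mul_le_mul_of_nonneg_left h2 (mul_nonneg (by positivity) (by linarith))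
  have h5 : (n : ℝ) * (x * (1 - x) * (1 - 3 * x * (1 - x))) ≤ n * 1 :=
    mul_le_mul_of_nonneg_left h3 (by positivity)
  have h6 : 3 * (n : ℝ) * (n - 1) * (x * (1 - x)) ^ 2
      + n * (x * (1 - x) * (1 - 3 * x * (1 - x))) ≤ 4 * (n : ℝ) ^ 2 := by nlinarith
  calc ((n : ℝ) ^ 4)⁻¹ * _ ≤ ((n : ℝ) ^ 4)⁻¹ * (4 * (n : ℝ) ^ 2) := by gcongr
    _ = 4 / (n : ℝ) ^ 2 := by field_simp

/-! ### Second order Taylor expansion in one variable -/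

lemma abs_taylor_two_sub_le {J : Set ℝ} (hJ : J.OrdConnected) {g g' g'' : ℝ → ℝ} {x s A ε : ℝ}
    (hx : x ∈ J) (hs : s ∈ J)
    (hg : ∀ r ∈ J, HasDerivWithinAt g (g' r) J r)
    (hg' : ∀ r ∈ J, HasDerivWithinAt g' (g'' r) J r)
    (hA : ∀ r ∈ Set.uIcc x s, |g'' r - A| ≤ ε) :
    |g s - g x - g' x * (s - x) - A / 2 * (s - x) ^ 2| ≤ ε * (s - x) ^ 2 := by
  have hsub : Set.uIcc x s ⊆ J := hJ.uIcc_subset hx hs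
  have hxu : x ∈ Set.uIcc x s := Set.left_mem_uIcc
  have hε : 0 ≤ ε := (abs_nonneg _).trans (hA x hxu)
  have hder' : ∀ r ∈ Set.uIcc x s, HasDerivWithinAt (fun r => g' r - A * (r - x)) (g'' r - A)
      (Set.uIcc x s) r := fun r hr => by
    have h := ((hg' r (hsub hr)).mono hsub).sub
      (((hasDerivWithinAt_id r (Set.uIcc x s)).sub_const x).const_mul A)
    exact h.congr_deriv (by simp)
  have hbd' : ∀ r ∈ Set.uIcc x s, |g' r - g' x - A * (r - x)| ≤ ε * |s - x| := fun r hr => by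
    have h := (convex_uIcc x s).norm_image_sub_le_of_norm_hasDerivWithin_le hder' hA hxu hr
    have h' : |r - x| ≤ |s - x| := Set.abs_sub_left_of_mem_uIcc hr
    calc |g' r - g' x - A * (r - x)| = ‖g' r - A * (r - x) - (g' x - A * (x - x))‖ := by
          rw [Real.norm_eq_abs]
          congr 1
          ring
      _ ≤ ε * ‖r - x‖ := h
      _ ≤ ε * |s - x| := mul_le_mul_of_nonneg_left h' hε
  have hder : ∀ r ∈ Set.uIcc x s,
      HasDerivWithinAt (fun r => g r - g' x * (r - x) - A / 2 * (r - x) ^ 2)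
        (g' r - g' x - A * (r - x)) (Set.uIcc x s) r := fun r hr => by
    have hid := (hasDerivWithinAt_id r (Set.uIcc x s)).sub_const x
    have h := (((hg r (hsub hr)).mono hsub).sub (hid.const_mul (g' x))).sub
      ((hid.pow 2).const_mul (A / 2))
    refine h.congr_deriv ?_
    simp
    ring
  have h := (convex_uIcc x s).norm_image_sub_le_of_norm_hasDerivWithin_le hder hbd' hxu
    Set.right_mem_uIcc
  calc |g s - g x - g' x * (s - x) - A / 2 * (s - x) ^ 2|
      = ‖g s - g' x * (s - x) - A / 2 * (s - x) ^ 2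
          - (g x - g' x * (x - x) - A / 2 * (x - x) ^ 2)‖ := by
        rw [Real.norm_eq_abs]
        congr 1
        ring
    _ ≤ ε * |s - x| * ‖s - x‖ := h
    _ = ε * (s - x) ^ 2 := by rw [Real.norm_eq_abs, mul_assoc, abs_mul_abs_self, sq]

/-! ### Regularity of the partial derivative on the unit square -/

lemma uniqueDiffOn_unitSquare : UniqueDiffOn ℝ unitSquare :=
  (uniqueDiffOn_Icc one_pos).prod (uniqueDiffOn_Icc one_pos)

lemma hasDerivWithinAt_pderivX {f : ℝ × ℝ → ℝ} (hf : DifferentiableOn ℝ f unitSquare) {s t : ℝ}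
    (hs : s ∈ Set.Icc (0 : ℝ) 1) (ht : t ∈ Set.Icc (0 : ℝ) 1) :
    HasDerivWithinAt (fun r => f (r, t)) (pderivX f (s, t)) (Set.Icc 0 1) s := by
  have h : DifferentiableWithinAt ℝ (fun r => f (r, t)) (Set.Icc 0 1) s :=
    DifferentiableWithinAt.comp (t := unitSquare) s (hf (s, t) ⟨hs, ht⟩)
      (by fun_prop) (fun r hr => ⟨hr, ht⟩)
  exact h.hasDerivWithinAt

lemma pderivX_eq_fderivWithin {f : ℝ × ℝ → ℝ} (hf : DifferentiableOn ℝ f unitSquare)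
    {p : ℝ × ℝ} (hp : p ∈ unitSquare) :
    pderivX f p = fderivWithin ℝ f unitSquare p (1, 0) := by
  have h1 : HasDerivWithinAt (fun r : ℝ => (r, p.2)) (1, 0) (Set.Icc 0 1) p.1 :=
    (hasDerivWithinAt_id p.1 _).prodMk (hasDerivWithinAt_const p.1 _ p.2)
  have h2 := HasFDerivWithinAt.comp_hasDerivWithinAt (t := unitSquare) p.1
    (hf p hp).hasFDerivWithinAt h1 (fun r hr => ⟨hr, hp.2⟩)
  exact h2.derivWithin (uniqueDiffOn_Icc one_pos p.1 hp.1)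

lemma ContDiffOn.pderivX {f : ℝ × ℝ → ℝ} {m n : WithTop ℕ∞} (hf : ContDiffOn ℝ n f unitSquare)
    (hmn : m + 1 ≤ n) : ContDiffOn ℝ m (pderivX f) unitSquare := by
  have hd : DifferentiableOn ℝ f unitSquare :=
    (hf.of_le (le_add_self.trans hmn)).differentiableOn one_ne_zero
  exact ((hf.fderivWithin uniqueDiffOn_unitSquare hmn).clm_apply contDiffOn_const).congr
    fun p hp => pderivX_eq_fderivWithin hd hp

/-- Second order Taylor expansion in the first variable, with a remainder that is uniform in
the second variable: `o(u²)` near `(x, y)` and fourth order away from it. -/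
lemma exists_abs_taylor_pderivX_le {f : ℝ × ℝ → ℝ} (hf : ContDiffOn ℝ 2 f unitSquare) {x y : ℝ}
    (hx : x ∈ Set.Icc (0 : ℝ) 1) (hy : y ∈ Set.Icc (0 : ℝ) 1) {ε : ℝ} (hε : 0 < ε) :
    ∃ C, 0 ≤ C ∧ ∀ s ∈ Set.Icc (0 : ℝ) 1, ∀ t ∈ Set.Icc (0 : ℝ) 1,
      |f (s, t) - f (x, t) - pderivX f (x, t) * (s - x)
          - pderivX (pderivX f) (x, y) / 2 * (s - x) ^ 2|
        ≤ ε * (s - x) ^ 2 + C * ((s - x) ^ 4 + (s - x) ^ 2 * (t - y) ^ 2) := by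
  have hf1 : ContDiffOn ℝ 1 (pderivX f) unitSquare :=
    hf.pderivX (by norm_num [one_add_one_eq_two])
  have hf2 : ContinuousOn (pderivX (pderivX f)) unitSquare :=
    (hf1.pderivX (m := 0) (by simp)).continuousOn
  have hd := hf.differentiableOn two_ne_zero
  have hd1 := hf1.differentiableOn one_ne_zero
  set A := pderivX (pderivX f) (x, y)
  have hcompact : IsCompact unitSquare := isCompact_Icc.prod isCompact_Icc
  obtain ⟨M, hM⟩ := hcompact.exists_bound_of_continuousOn (hf2.sub (continuousOn_const (c := A)))
  have hM0 : 0 ≤ M := (norm_nonneg _).trans (hM (x, y) ⟨hx, hy⟩)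
  obtain ⟨δ, hδ, hnear⟩ := Metric.continuousWithinAt_iff.1 (hf2 (x, y) ⟨hx, hy⟩) ε hε
  refine ⟨M / δ ^ 2, by positivity, fun s hs t ht => ?_⟩
  have taylor : ∀ η, (∀ r ∈ Set.uIcc x s, |pderivX (pderivX f) (r, t) - A| ≤ η) →
      |f (s, t) - f (x, t) - pderivX f (x, t) * (s - x) - A / 2 * (s - x) ^ 2|
        ≤ η * (s - x) ^ 2 := fun η hη =>
    abs_taylor_two_sub_le (J := Set.Icc 0 1) (g := fun r => f (r, t))
      (g' := fun r => pderivX f (r, t)) Set.ordConnected_Icc hx hs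
      (fun r hr => hasDerivWithinAt_pderivX hd hr ht)
      (fun r hr => hasDerivWithinAt_pderivX hd1 hr ht) hη
  have hsub : Set.uIcc x s ⊆ Set.Icc 0 1 := Set.ordConnected_Icc.uIcc_subset hx hs
  by_cases hclose : |s - x| < δ ∧ |t - y| < δ
  · have h := taylor ε fun r hr => by
      have hr' : |r - x| ≤ |s - x| := Set.abs_sub_left_of_mem_uIcc hr
      refine (hnear (x := (r, t)) ⟨hsub hr, ht⟩ ?_).le
      rw [Prod.dist_eq]
      exact max_lt (hr'.trans_lt hclose.1) hclose.2
    have : 0 ≤ M / δ ^ 2 * ((s - x) ^ 4 + (s - x) ^ 2 * (t - y) ^ 2) := by positivity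
    linarith
  · have h := taylor M fun r hr => hM (r, t) ⟨hsub hr, ht⟩
    have hfar : δ ^ 2 ≤ (s - x) ^ 2 + (t - y) ^ 2 := by
      rw [not_and_or, not_lt, not_lt] at hclose
      rcases hclose with h | h
      · have := sq_le_sq.2 ((abs_of_pos hδ).trans_le h)
        linarith [sq_nonneg (t - y)]
      · have := sq_le_sq.2 ((abs_of_pos hδ).trans_le h)
        linarith [sq_nonneg (s - x)]
    have : M * (s - x) ^ 2 ≤ M / δ ^ 2 * ((s - x) ^ 4 + (s - x) ^ 2 * (t - y) ^ 2) :=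
      calc M * (s - x) ^ 2 = M / δ ^ 2 * ((s - x) ^ 2 * δ ^ 2) := by field_simp
        _ ≤ M / δ ^ 2 * ((s - x) ^ 2 * ((s - x) ^ 2 + (t - y) ^ 2)) := by gcongr
        _ = _ := by ring
    have : 0 ≤ ε * (s - x) ^ 2 := by positivity
    linarith

/-! ### The Voronovskaya limit -/

lemma div_mem_Icc_of_mem_range {n k : ℕ} (hk : k ∈ range (n + 1)) :
    (k : ℝ) / n ∈ Set.Icc (0 : ℝ) 1 :=
  ⟨by positivity, div_le_one_of_le₀ (by exact_mod_cast Nat.lt_succ_iff.1 (mem_range.1 hk))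
    (Nat.cast_nonneg n)⟩

/-- A double sum of products against Bernstein weights factors. -/
lemma sum_sum_mul_bern (n : ℕ) (x y : ℝ) (a b : ℕ → ℝ) :
    ∑ k ∈ range (n + 1), ∑ l ∈ range (n + 1), a k * b l * bern n k x * bern n l y
      = (∑ k ∈ range (n + 1), a k * bern n k x) * ∑ l ∈ range (n + 1), b l * bern n l y := by
  rw [sum_mul_sum]
  exact sum_congr rfl fun k _ => sum_congr rfl fun l _ => by ring

/-- Contribution of the increments in the first variable to the Voronovskaya limit. -/
lemma tendsto_sum_sum_sub_mul_bern {f : ℝ × ℝ → ℝ} (hf : ContDiffOn ℝ 2 f unitSquare) {x y : ℝ}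
    (hx : x ∈ Set.Icc (0 : ℝ) 1) (hy : y ∈ Set.Icc (0 : ℝ) 1) :
    Tendsto (fun n : ℕ => (n : ℝ) * ∑ k ∈ range (n + 1), ∑ l ∈ range (n + 1),
        (f ((k : ℝ) / n, (l : ℝ) / n) - f (x, (l : ℝ) / n)) * bern n k x * bern n l y) atTop
      (nhds (x * (1 - x) / 2 * pderivX (pderivX f) (x, y))) := by
  set A := pderivX (pderivX f) (x, y)
  have var_le : ∀ z ∈ Set.Icc (0 : ℝ) 1, 0 ≤ z * (1 - z) ∧ z * (1 - z) ≤ 1 := fun z hz =>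
    ⟨mul_nonneg hz.1 (by linarith [hz.2]), by nlinarith [sq_nonneg z, hz.2]⟩
  rw [Metric.tendsto_atTop]
  intro ε hε
  obtain ⟨C, hC, hCle⟩ := exists_abs_taylor_pderivX_le hf hx hy (half_pos hε)
  obtain ⟨N, hN⟩ := exists_nat_gt (5 * C / (ε / 2))
  refine ⟨N + 1, fun n hn => ?_⟩
  have hn0 : n ≠ 0 := by lia
  have hnpos : (0 : ℝ) < n := by exact_mod_cast Nat.pos_of_ne_zero hn0
  set R : ℕ → ℕ → ℝ := fun k l =>
    f ((k : ℝ) / n, (l : ℝ) / n) - f (x, (l : ℝ) / n)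
      - pderivX f (x, (l : ℝ) / n) * ((k : ℝ) / n - x) - A / 2 * ((k : ℝ) / n - x) ^ 2 with hR
  have hsplit : ∑ k ∈ range (n + 1), ∑ l ∈ range (n + 1),
      (f ((k : ℝ) / n, (l : ℝ) / n) - f (x, (l : ℝ) / n)) * bern n k x * bern n l y
      = A / 2 * (x * (1 - x) / n)
        + ∑ k ∈ range (n + 1), ∑ l ∈ range (n + 1), R k l * bern n k x * bern n l y := by
    have h1 := sum_sum_mul_bern n x y (fun k => (k : ℝ) / n - x)
      (fun l => pderivX f (x, (l : ℝ) / n))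
    have h2 := sum_sum_mul_bern n x y (fun k => ((k : ℝ) / n - x) ^ 2) (fun _ => A / 2)
    rw [sum_div_sub_mul_bern hn0, zero_mul] at h1
    rw [sum_div_sub_sq_mul_bern hn0, ← mul_sum, sum_bern, mul_one, mul_comm] at h2
    rw [← h2, ← add_zero (∑ k ∈ range (n + 1), ∑ l ∈ range (n + 1), _ * _ * _ * _), ← h1]
    simp only [← sum_add_distrib]
    exact sum_congr rfl fun k _ => sum_congr rfl fun l _ => by
      simp only [hR]
      ring
  have hrem : |∑ k ∈ range (n + 1), ∑ l ∈ range (n + 1), R k l * bern n k x * bern n l y|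
      ≤ ε / 2 / n + 5 * C / (n : ℝ) ^ 2 := by
    have h1 := sum_sum_mul_bern n x y (fun k => ((k : ℝ) / n - x) ^ 2) (fun _ => 1)
    have h2 := sum_sum_mul_bern n x y (fun k => ((k : ℝ) / n - x) ^ 4) (fun _ => 1)
    have h3 := sum_sum_mul_bern n x y (fun k => ((k : ℝ) / n - x) ^ 2)
      (fun l => ((l : ℝ) / n - y) ^ 2)
    simp only [one_mul, sum_bern, mul_one, sum_div_sub_sq_mul_bern hn0] at h1 h2 h3
    have h4 := sum_div_sub_pow_four_mul_bern_le hn0 hx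
    have hxv : x * (1 - x) / n ≤ 1 / n := by
      gcongr
      exact (var_le x hx).2
    have hxyv : x * (1 - x) / n * (y * (1 - y) / n) ≤ 1 / n * (1 / n) := by
      have := (var_le y hy).1
      have hyv : y * (1 - y) / n ≤ 1 / n := by
        gcongr
        exact (var_le y hy).2
      exact mul_le_mul hxv hyv (by positivity) (by positivity)
    calc |∑ k ∈ range (n + 1), ∑ l ∈ range (n + 1), R k l * bern n k x * bern n l y|
        ≤ ∑ k ∈ range (n + 1), ∑ l ∈ range (n + 1), |R k l * bern n k x * bern n l y| :=
          (abs_sum_le_sum_abs _ _).trans (sum_le_sum fun k _ => abs_sum_le_sum_abs _ _)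
      _ ≤ ∑ k ∈ range (n + 1), ∑ l ∈ range (n + 1),
          (ε / 2 * ((k : ℝ) / n - x) ^ 2 + C * (((k : ℝ) / n - x) ^ 4
            + ((k : ℝ) / n - x) ^ 2 * ((l : ℝ) / n - y) ^ 2)) * bern n k x * bern n l y := by
          refine sum_le_sum fun k hk => sum_le_sum fun l hl => ?_
          have hbk := bern_nonneg n k hx
          have hbl := bern_nonneg n l hy
          rw [abs_mul, abs_mul, abs_of_nonneg hbk, abs_of_nonneg hbl]
          gcongr
          exact hCle _ (div_mem_Icc_of_mem_range hk) _ (div_mem_Icc_of_mem_range hl)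
      _ = ε / 2 * (x * (1 - x) / n)
          + C * (∑ k ∈ range (n + 1), ((k : ℝ) / n - x) ^ 4 * bern n k x
            + x * (1 - x) / n * (y * (1 - y) / n)) := by
          rw [← h3, ← h1, ← h2]
          simp only [← sum_add_distrib, mul_sum]
          exact sum_congr rfl fun k _ => sum_congr rfl fun l _ => by ring
      _ ≤ ε / 2 * (1 / n) + C * (4 / (n : ℝ) ^ 2 + 1 / n * (1 / n)) := by gcongr
      _ = ε / 2 / n + 5 * C / (n : ℝ) ^ 2 := by
          field_simp
          ring
  have hNn : 5 * C / (ε / 2) < n := hN.trans (by exact_mod_cast hn)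
  have hlast : 5 * C / n < ε / 2 := by
    rw [div_lt_iff₀ (half_pos hε)] at hNn
    rw [div_lt_iff₀ hnpos]
    linarith
  rw [Real.dist_eq, hsplit]
  have hcancel : (n : ℝ) * (A / 2 * (x * (1 - x) / n)
      + ∑ k ∈ range (n + 1), ∑ l ∈ range (n + 1), R k l * bern n k x * bern n l y)
      - x * (1 - x) / 2 * A
      = n * ∑ k ∈ range (n + 1), ∑ l ∈ range (n + 1), R k l * bern n k x * bern n l y := by
    field_simp
    ring
  rw [hcancel, abs_mul, abs_of_pos hnpos]
  calc (n : ℝ) * _ ≤ n * (ε / 2 / n + 5 * C / (n : ℝ) ^ 2) :=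
        mul_le_mul_of_nonneg_left hrem hnpos.le
    _ = ε / 2 + 5 * C / n := by field_simp
    _ < ε := by linarith

theorem stmt_12 (x y : ℝ) (hx : x ∈ Set.Icc (0 : ℝ) 1) (hy : y ∈ Set.Icc (0 : ℝ) 1)
    (f : ℝ × ℝ → ℝ) (hf : ContDiffOn ℝ 2 f unitSquare) :
    Tendsto (fun n : ℕ => (n : ℝ) * (bernstein2Op n f x y - f (x, y))) atTop
      (nhds (x * (1 - x) / 2 * pderivX (pderivX f) (x, y)
        + y * (1 - y) / 2 * pderivY (pderivY f) (x, y))) := by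
  have hg : ContDiffOn ℝ 2 (fun p : ℝ × ℝ => f (x, p.1)) unitSquare :=
    hf.comp (contDiff_const.prodMk contDiff_fst).contDiffOn fun p hp => ⟨hx, hp.1⟩
  have hX := tendsto_sum_sum_sub_mul_bern hf hx hy
  have hY := tendsto_sum_sum_sub_mul_bern hg hy hx
  refine (hX.add hY).congr fun n => ?_
  rw [← mul_add, bernstein2Op]
  congr 1
  have h := sum_sum_mul_bern n x y (fun _ => 1) (fun l => f (x, (l : ℝ) / n))
  simp only [one_mul, sum_bern] at h
  simp only [sub_mul, sum_sub_distrib, ← mul_sum, sum_bern, mul_one, h]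
  ring
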